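/- Let A and B be finite sets with |A| ≥ |B| ≥ 1, let k ≥ 1, let R^A be a k-ary relation on A all of whose tuples have pairwise distinct entries, and let R^B be a k-ary relation on B. Then there exists a surjective function h : A → B with Val(h) ≥ (1 − k·|B|/|A|) · (|R^B|/|B|^k) · |R^A| (as an inequality of rational numbers). -/

import Mathlib

/-- Some `n`-element subset has average `f`-value at most the overall average. -/
theorem exists_card_eq_sum_le {A : Type*} [Fintype A] [DecidableEq A] (f : A → ℕ) {n : ℕ}
    (hn : n ≤ Fintype.card A) :
    ∃ S : Finset A, S.card = n ∧ Fintype.card A * ∑ a ∈ S, f a ≤ n * ∑ a, f a := by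
  induction hn using Nat.decreasingInduction with
  | self => exact ⟨Finset.univ, rfl, le_rfl⟩
  | of_succ n _ ih =>
    obtain ⟨S, hS, hle⟩ := ih
    have hne : S.Nonempty := Finset.card_pos.mp (by omega)
    obtain ⟨a, ha, hmax⟩ := Finset.exists_max_image S f hne
    refine ⟨S.erase a, by rw [Finset.card_erase_of_mem ha]; omega, ?_⟩
    have hsum : ∑ x ∈ S.erase a, f x ≤ n * f a := by
      have := Finset.sum_le_card_nsmul (S.erase a) f (f a)
        fun x hx => hmax x (Finset.mem_of_mem_erase hx)
      rwa [Finset.card_erase_of_mem ha, hS, Nat.add_sub_cancel, smul_eq_mul] at this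
    rw [← Finset.add_sum_erase S f ha] at hle
    have h1 := Nat.mul_le_mul_left (Fintype.card A) hsum
    have h2 := Nat.mul_le_mul_left n hle
    refine le_of_mul_le_mul_left ?_ n.succ_pos
    linarith

/-- If `t` is injective, then `g ∘ t` is uniformly distributed when `g` is. -/
theorem card_filter_comp_mem_mul {A B : Type*} [Fintype A] [DecidableEq A] [Fintype B]
    [DecidableEq B] {k : ℕ} {t : Fin k → A} (ht : Function.Injective t)
    (R : Finset (Fin k → B)) :
    (Finset.univ.filter fun g : A → B => g ∘ t ∈ R).card * Fintype.card B ^ k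
      = Fintype.card (A → B) * R.card := by
  have hk : Fintype.card B ^ k = (Finset.univ : Finset (Fin k → B)).card := by simp
  have hcomp (g : A → B) (u : Fin k → B) : Function.extend t u g ∘ t = u :=
    funext fun i => ht.extend_apply u g i
  have hext (g : A → B) (u : Fin k → B) :
      Function.extend t (g ∘ t) (Function.extend t u g) = g := by
    funext a
    by_cases ha : ∃ i, t i = a
    · obtain ⟨i, rfl⟩ := ha
      simp [ht.extend_apply]
    · simp [Function.extend_apply' _ _ _ ha]
  rw [hk, ← Finset.card_univ, ← Finset.card_product, ← Finset.card_product]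
  refine Finset.card_nbij' (fun p => (Function.extend t p.2 p.1, p.1 ∘ t))
    (fun p => (Function.extend t p.2 p.1, p.1 ∘ t)) ?_ ?_ ?_ ?_
  · rintro ⟨g, u⟩ h
    simpa using h
  · rintro ⟨g, u⟩ h
    simpa [hcomp] using h
  · rintro ⟨g, u⟩ -
    simp [hcomp, hext]
  · rintro ⟨g, u⟩ -
    simp [hcomp, hext]

/-- Some function satisfies at least the expected number of tuples with distinct entries. -/
theorem exists_card_mul_le_card_filter_comp_mem {A B : Type*} [Fintype A] [DecidableEq A]
    [Fintype B] [DecidableEq B] [Nonempty B] {k : ℕ} (T : Finset (Fin k → A))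
    (hT : ∀ t ∈ T, Function.Injective t) (R : Finset (Fin k → B)) :
    ∃ g : A → B,
      T.card * R.card ≤ (T.filter fun t => g ∘ t ∈ R).card * Fintype.card B ^ k := by
  have hsum : ∑ _g : A → B, T.card * R.card
      = ∑ g : A → B, (T.filter fun t => g ∘ t ∈ R).card * Fintype.card B ^ k := by
    have hswap : ∑ g : A → B, (T.filter fun t => g ∘ t ∈ R).card
        = ∑ t ∈ T, (Finset.univ.filter fun g : A → B => g ∘ t ∈ R).card :=
      Finset.sum_card_bipartiteAbove_eq_sum_card_bipartiteBelow _
    rw [← Finset.sum_mul Finset.univ _ (Fintype.card B ^ k), hswap, Finset.sum_mul,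
      Finset.sum_congr rfl fun t ht => card_filter_comp_mem_mul (hT t ht) R]
    simp only [Finset.sum_const, smul_eq_mul, Finset.card_univ]
    ring
  obtain ⟨g, -, hg⟩ := Finset.exists_le_of_sum_le Finset.univ_nonempty hsum.le
  exact ⟨g, hg⟩

/-- Some `n`-element set meets at most a fraction `k * n / |A|` of the given `k`-tuples. -/
theorem exists_card_eq_card_filter_meets_le {A : Type*} [Fintype A] [DecidableEq A] {k n : ℕ}
    (hn : n ≤ Fintype.card A) (T : Finset (Fin k → A)) :
    ∃ S : Finset A, S.card = n ∧
      Fintype.card A * (T.filter fun t => ∃ i, t i ∈ S).card ≤ n * (k * T.card) := by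
  obtain ⟨S, hS, hle⟩ :=
    exists_card_eq_sum_le (fun a => (T.filter fun t : Fin k → A => ∃ i, t i = a).card) hn
  refine ⟨S, hS, (Nat.mul_le_mul_left _ ?_).trans (hle.trans (Nat.mul_le_mul_left _ ?_))⟩
  · refine (Finset.card_le_card ?_).trans Finset.card_biUnion_le
    intro t ht
    obtain ⟨htT, i, hi⟩ := Finset.mem_filter.mp ht
    exact Finset.mem_biUnion.mpr ⟨t i, hi, Finset.mem_filter.mpr ⟨htT, i, rfl⟩⟩
  · have hswap : ∑ a : A, (T.filter fun t => ∃ i, t i = a).card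
        = ∑ t ∈ T, (Finset.univ.filter fun a : A => ∃ i, t i = a).card :=
      Finset.sum_card_bipartiteAbove_eq_sum_card_bipartiteBelow _
    rw [hswap, mul_comm, ← smul_eq_mul]
    refine Finset.sum_le_card_nsmul _ _ _ fun t _ => ?_
    have : (Finset.univ.filter fun a : A => ∃ i, t i = a) = Finset.univ.image t := by
      ext a
      simp
    rw [this]
    exact Finset.card_image_le.trans (by simp)

theorem stmt_5 {A B : Type} [Fintype A] [DecidableEq A] [Fintype B] [DecidableEq B]
    (hBA : Fintype.card B ≤ Fintype.card A) (hB : 1 ≤ Fintype.card B)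
    (k : ℕ) (hk : 1 ≤ k)
    (RA : Finset (Fin k → A)) (RB : Finset (Fin k → B))
    (hdist : ∀ t ∈ RA, Function.Injective t) :
    ∃ h : A → B, Function.Surjective h ∧
      ((RA.filter (fun t => (h ∘ t) ∈ RB)).card : ℚ)
        ≥ (1 - k * (Fintype.card B : ℚ) / (Fintype.card A : ℚ))
          * ((RB.card : ℚ) / (Fintype.card B : ℚ) ^ k) * (RA.card : ℚ) := by
  have : Nonempty B := Fintype.card_pos_iff.mp hB
  obtain ⟨S, hS, hmeet⟩ := exists_card_eq_card_filter_meets_le hBA RA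
  let e : S ≃ B := Fintype.equivOfCardEq (by simpa using hS)
  obtain ⟨g, hg⟩ := exists_card_mul_le_card_filter_comp_mem
    (RA.filter fun t => ¬ ∃ i, t i ∈ S) (fun t ht => hdist t (Finset.mem_filter.mp ht).1) RB
  let h : A → B := fun a => if ha : a ∈ S then e ⟨a, ha⟩ else g a
  refine ⟨h, fun b => ⟨e.symm b, by simp [h]⟩, ?_⟩
  have hval : ((RA.filter fun t => ¬ ∃ i, t i ∈ S).filter fun t => g ∘ t ∈ RB).card
      ≤ (RA.filter fun t => h ∘ t ∈ RB).card := by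
    refine Finset.card_le_card fun t ht => ?_
    simp only [Finset.mem_filter, not_exists] at ht ⊢
    obtain ⟨⟨htA, htS⟩, htB⟩ := ht
    have : h ∘ t = g ∘ t := funext fun i => by simp [h, htS i]
    exact ⟨htA, this ▸ htB⟩
  have hsplit := Finset.card_filter_add_card_filter_not (s := RA) (fun t => ∃ i, t i ∈ S)
  have hgood := hg.trans (Nat.mul_le_mul_right _ hval)
  have hA : (0 : ℚ) < Fintype.card A := by exact_mod_cast hB.trans hBA
  have hBk : (0 : ℚ) < (Fintype.card B : ℚ) ^ k := pow_pos (by exact_mod_cast hB) k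
  set good := (RA.filter fun t => ¬ ∃ i, t i ∈ S).card
  set bad := (RA.filter fun t => ∃ i, t i ∈ S).card
  have hfrac : (1 - k * (Fintype.card B : ℚ) / Fintype.card A) * RA.card ≤ good := by
    have hbad : (bad : ℚ) ≤ k * (Fintype.card B : ℚ) / Fintype.card A * RA.card := by
      rw [div_mul_eq_mul_div, le_div_iff₀ hA]
      have : (Fintype.card A : ℚ) * bad ≤ Fintype.card B * (k * RA.card) := by
        exact_mod_cast hmeet
      linarith
    have : (bad : ℚ) + good = RA.card := by exact_mod_cast hsplit
    linarith
  calc _ = (1 - k * (Fintype.card B : ℚ) / Fintype.card A) * RA.card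
          * (RB.card / (Fintype.card B : ℚ) ^ k) := by ring
    _ ≤ good * (RB.card / (Fintype.card B : ℚ) ^ k) := by gcongr
    _ ≤ _ := by
      rw [← mul_div_assoc, div_le_iff₀ hBk]
      exact_mod_cast hgood
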